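/- Let (w,α) ∈ S_{λ,μ} and let i, j with j = i ± 1 be such that k_i := ⟨w(λ+ρ), α_i^∨⟩ < 0, k_j := ⟨w(λ+ρ), α_j^∨⟩ < 0, f_i^{−k_i}(α) ≠ 0 and f_j^{−k_j}(α) ≠ 0. Set p = −k_i and q = −k_j. Then f_i^{q}(f_j^{p+q}(f_i^{p}(α))) = f_j^{p}(f_i^{p+q}(f_j^{q}(α))) ≠ 0 (this is the braid relation Φ_iΦ_jΦ_i(α) = Φ_jΦ_iΦ_j(α) ≠ 0 for the operators Φ_l = f_l^{−k_l} with the exponents updated along the way by the Weyl group action). -/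

import Mathlib

open scoped BigOperators

namespace KFC

/-- A (candidate) root is a pair of 1-based indices. -/
abbrev Root : Type := ℕ × ℕ

/-- A Kostant partition is encoded as a multiplicity function on pairs. -/
abbrev KPf : Type := Root → ℕ

/-- An entry of a signed word: a sign (`true` = '+', `false` = '−') together
with the root lying under it. -/
abbrev Entry : Type := Bool × Root

/-- `p` is a positive root of type `A_{n-1}`. -/
def IsPos (n : ℕ) (p : Root) : Prop := 1 ≤ p.1 ∧ p.1 < p.2 ∧ p.2 ≤ n

/-- `α` is a genuine Kostant partition for type `A_{n-1}`: it is supported on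
positive roots. -/
def IsKP (n : ℕ) (α : KPf) : Prop := ∀ p, α p ≠ 0 → IsPos n p

/-- Add one copy of the root `r`. -/
def KPadd (α : KPf) (r : Root) : KPf := fun p => if p = r then α p + 1 else α p

/-- Remove one copy of the root `r`. -/
def KPsub (α : KPf) (r : Root) : KPf := fun p => if p = r then α p - 1 else α p

/-- Replace one copy of `r` by one copy of `r'`. -/
def KPmove (α : KPf) (r r' : Root) : KPf := KPadd (KPsub α r) r'

/-- The signed word `W_i` of `α`: roots `(a,b)` ordered by decreasing `a` and,
for equal `a`, increasing `b`; a '+' under each `(h,i)` and a '−' under each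
`(h,i+1)`. -/
def Wword (n i : ℕ) (α : KPf) : List Entry :=
  ((List.range (n+1)).reverse).flatMap (fun h =>
    List.replicate (α (h, i)) ((true, (h, i)) : Entry) ++
    List.replicate (α (h, i+1)) ((false, (h, i+1)) : Entry))

/-- The signed word `W_i*` of `α`: roots `(a,b)` ordered by increasing `b` and,
for equal `b`, decreasing `a`; a '+' under each `(i+1,j)` and a '−' under each
`(i,j)`. -/
def Wstar (n i : ℕ) (α : KPf) : List Entry :=
  (List.range (n+1)).flatMap (fun j =>
    List.replicate (α (i+1, j)) ((true, (i+1, j)) : Entry) ++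
    List.replicate (α (i, j)) ((false, (i, j)) : Entry))

/-- One step of the left-to-right reduction: a new '+' cancels the rightmost
surviving '−' (the surviving word always has the shape `+^a −^b`). -/
def redStep (s : List Entry) (e : Entry) : List Entry :=
  match e.1, s.getLast? with
  | true, some (false, _) => s.dropLast
  | _, _ => s ++ [e]

/-- The reduced word (list of surviving entries, in order). -/
def reduceW (w : List Entry) : List Entry := w.foldl redStep []

def plusCt (w : List Entry) : ℕ := (w.filter (fun e => e.1)).length
def minusCt (w : List Entry) : ℕ := (w.filter (fun e => !e.1)).length

/-- `a_i`: number of '+' in the reduced word of `W_i`. -/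
def aSt (n i : ℕ) (α : KPf) : ℕ := plusCt (reduceW (Wword n i α))
/-- `b_i`: number of '−' in the reduced word of `W_i`. -/
def bSt (n i : ℕ) (α : KPf) : ℕ := minusCt (reduceW (Wword n i α))
/-- `a_i*`. -/
def aStar (n i : ℕ) (α : KPf) : ℕ := plusCt (reduceW (Wstar n i α))
/-- `b_i*`. -/
def bStar (n i : ℕ) (α : KPf) : ℕ := minusCt (reduceW (Wstar n i α))
/-- `u_i`: number of '+' in the reduced word of `W_i* W_i`. -/
def uSt (n i : ℕ) (α : KPf) : ℕ := plusCt (reduceW (Wstar n i α ++ Wword n i α))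
/-- `v_i`: number of '−' in the reduced word of `W_i* W_i`. -/
def vSt (n i : ℕ) (α : KPf) : ℕ := minusCt (reduceW (Wstar n i α ++ Wword n i α))

/-- The root under the rightmost surviving '+'. -/
def lastPlus (w : List Entry) : Option Root :=
  (((reduceW w).filter (fun e => e.1)).getLast?).map Prod.snd

/-- The root under the leftmost surviving '−'. -/
def headMinus (w : List Entry) : Option Root :=
  (((reduceW w).filter (fun e => !e.1)).head?).map Prod.snd

/-- The operator `f̃_i`. -/
def ftilde (n i : ℕ) (α : KPf) : Option KPf :=
  match lastPlus (Wword n i α) with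
  | some r => some (KPmove α r (r.1, i+1))
  | none => some (KPadd α (i, i+1))

/-- The operator `ẽ_i`. -/
def etilde (n i : ℕ) (α : KPf) : Option KPf :=
  match headMinus (Wword n i α) with
  | some r => if r = (i, i+1) then some (KPsub α (i, i+1)) else some (KPmove α r (r.1, i))
  | none => none

/-- The operator `f̃_i*`. -/
def ftildeS (n i : ℕ) (α : KPf) : Option KPf :=
  match lastPlus (Wstar n i α) with
  | some r => some (KPmove α r (i, r.2))
  | none => some (KPadd α (i, i+1))

/-- The operator `ẽ_i*`. -/
def etildeS (n i : ℕ) (α : KPf) : Option KPf :=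
  match headMinus (Wstar n i α) with
  | some r => if r = (i, i+1) then some (KPsub α (i, i+1)) else some (KPmove α r (i+1, r.2))
  | none => none

/-- The modified operator `f_i`. -/
def fop (n i : ℕ) (α : KPf) : Option KPf :=
  if bStar n i α < aSt n i α then ftilde n i α
  else if 0 < aStar n i α then ftildeS n i α
  else none

/-- The modified operator `e_i`. -/
def eop (n i : ℕ) (α : KPf) : Option KPf :=
  if bStar n i α ≤ aSt n i α then
    (if 0 < bSt n i α ∧ headMinus (Wword n i α) ≠ some (i, i+1) then etilde n i α else none)
  else
    (if headMinus (Wstar n i α) ≠ some (i, i+1) then etildeS n i α else none)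

/-- The operator `ê_i`. -/
def ehat (n i : ℕ) (α : KPf) : Option KPf :=
  if bStar n i α ≤ aSt n i α then (if 0 < bSt n i α then etilde n i α else none)
  else etildeS n i α

/-- Iterate a partially defined operator (`none` plays the role of `0`). -/
def iterO (g : KPf → Option KPf) : ℕ → KPf → Option KPf
  | 0, x => some x
  | k+1, x => (g x).bind (iterO g k)

/-- `ε_i(x) = max {k : e_i^k x ≠ 0}`. -/
noncomputable def epsS (n i : ℕ) (x : KPf) : ℕ := sSup {k | iterO (eop n i) k x ≠ none}
/-- `ε̂_i(x) = max {k : ê_i^k x ≠ 0}`. -/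
noncomputable def epsHatS (n i : ℕ) (x : KPf) : ℕ := sSup {k | iterO (ehat n i) k x ≠ none}
/-- `φ_i(x) = max {k : f_i^k x ≠ 0}`. -/
noncomputable def phiS (n i : ℕ) (x : KPf) : ℕ := sSup {k | iterO (fop n i) k x ≠ none}

noncomputable def epsO (n i : ℕ) (o : Option KPf) : ℕ := o.elim 0 (epsS n i)
noncomputable def epsHatO (n i : ℕ) (o : Option KPf) : ℕ := o.elim 0 (epsHatS n i)
noncomputable def phiO (n i : ℕ) (o : Option KPf) : ℕ := o.elim 0 (phiS n i)

/-- `e_l(γ) ≃ 0`. -/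
def simZero (n l : ℕ) (γ : KPf) : Prop := eop n l γ ≠ ehat n l γ

/-- `e_l e_m (γ) ≃ 0`. -/
def simZero2 (n l m : ℕ) (γ : KPf) : Prop := ∃ δ, eop n m γ = some δ ∧ simZero n l δ

/-- The box containing all relevant pairs. -/
def kbox (n : ℕ) : Finset (ℕ × ℕ) := Finset.range (n+1) ×ˢ Finset.range (n+1)

/-- `|α|`: number of parts of the Kostant partition. -/
def kpSize (n : ℕ) (α : KPf) : ℕ := ∑ p ∈ kbox n, α p

/-- The evaluation `ᾱ ∈ ℤ^n` (as a function on 1-based coordinates). -/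
def kpEval (n : ℕ) (α : KPf) : ℕ → ℤ :=
  fun k => ∑ p ∈ kbox n, (α p : ℤ) * ((if p.1 = k then 1 else 0) - (if p.2 = k then 1 else 0))

/-- The simple root `α_i = ε_i − ε_{i+1}` as a vector. -/
def srVec (i : ℕ) : ℕ → ℤ := fun k => (if k = i then 1 else 0) - (if k = i+1 then 1 else 0)

/-- `ρ = (n-1, n-2, …, 1, 0)` (on 1-based coordinates `1..n`). -/
def rhoVec (n : ℕ) : ℕ → ℤ := fun k => (n : ℤ) - k

/-- `⟨γ, α_i^∨⟩ = γ_i − γ_{i+1}`. -/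
def pairCo (γ : ℕ → ℤ) (i : ℕ) : ℤ := γ i - γ (i+1)

/-- The permutation of 1-based coordinates induced by `w : Perm (Fin n)`. -/
def extP (n : ℕ) (w : Equiv.Perm (Fin n)) (k : ℕ) : ℕ :=
  if h : 1 ≤ k ∧ k ≤ n then ((w ⟨k - 1, by omega⟩ : Fin n) : ℕ) + 1 else k

/-- `S_n` acting on `ℤ^n` by permuting coordinates: `(w·v)_k = v_{w⁻¹(k)}`. -/
def permAct (n : ℕ) (w : Equiv.Perm (Fin n)) (v : ℕ → ℤ) : ℕ → ℤ :=
  fun k => v (extP n w⁻¹ k)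

/-- The simple transposition `s_i = (i, i+1)` (1-based). -/
def sT (n i : ℕ) : Equiv.Perm (Fin n) :=
  if h : 1 ≤ i ∧ i < n then Equiv.swap ⟨i - 1, by omega⟩ ⟨i, h.2⟩ else 1

/-- Coxeter length = number of inversions. -/
def lenP (n : ℕ) (w : Equiv.Perm (Fin n)) : ℕ :=
  (Finset.univ.filter (fun p : Fin n × Fin n => p.1 < p.2 ∧ w p.2 < w p.1)).card

/-- The left weak Bruhat order: `u ≤ w` iff `ℓ(w) = ℓ(w u⁻¹) + ℓ(u)`. -/
def leftWeakLE (n : ℕ) (u w : Equiv.Perm (Fin n)) : Prop :=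
  lenP n w = lenP n (w * u⁻¹) + lenP n u

/-- `λ + ρ` as a vector. -/
def lamRho (n : ℕ) (lam : ℕ → ℤ) : ℕ → ℤ := fun k => lam k + rhoVec n k

/-- `(w, α) ∈ S_{λ,μ}`, i.e. `ᾱ = w(λ+ρ) − (μ+ρ)`. -/
def InS (n : ℕ) (lam mu : ℕ → ℤ) (w : Equiv.Perm (Fin n)) (α : KPf) : Prop :=
  IsKP n α ∧ ∀ k, 1 ≤ k → k ≤ n →
    kpEval n α k = permAct n w (lamRho n lam) k - (mu k + rhoVec n k)

/-- A directed edge `(w,α) →^i (s_i w, β)` of the `Φ`-graph. -/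
def PhiEdge (n : ℕ) (lam mu : ℕ → ℤ) (v v' : Equiv.Perm (Fin n) × KPf) : Prop :=
  InS n lam mu v.1 v.2 ∧ InS n lam mu v'.1 v'.2 ∧
  ∃ i, 1 ≤ i ∧ i ≤ n - 1 ∧
    pairCo (permAct n v.1 (lamRho n lam)) i < 0 ∧
    v'.1 = sT n i * v.1 ∧
    iterO (fop n i) (-(pairCo (permAct n v.1 (lamRho n lam)) i)).toNat v.2 = some v'.2

/-- Being in the same connected component of (the underlying undirected graph of)
the `Φ`-graph. -/
def Conn (n : ℕ) (lam mu : ℕ → ℤ) (v v' : Equiv.Perm (Fin n) × KPf) : Prop :=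
  Relation.ReflTransGen (fun a b => PhiEdge n lam mu a b ∨ PhiEdge n lam mu b a) v v'

/-- `(w,β)` has a broken hexagon, broken by `Φ_i` after `Φ_j`. -/
def BrokenHexAt (n : ℕ) (lam mu : ℕ → ℤ) (w : Equiv.Perm (Fin n)) (β : KPf) (i j : ℕ) : Prop :=
  (j = i + 1 ∨ i = j + 1) ∧ 1 ≤ i ∧ i ≤ n - 1 ∧ 1 ≤ j ∧ j ≤ n - 1 ∧
  0 < pairCo (permAct n w (lamRho n lam)) i ∧
  0 < pairCo (permAct n w (lamRho n lam)) j ∧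
  iterO (eop n i) (pairCo (permAct n w (lamRho n lam)) i).toNat β ≠ none ∧
  ∃ δ, iterO (eop n j) (pairCo (permAct n w (lamRho n lam)) j).toNat β = some δ ∧
    epsS n i δ < (pairCo (permAct n w (lamRho n lam)) i).toNat +
      (pairCo (permAct n w (lamRho n lam)) j).toNat

/-- `γ` is obtained from `β` by an initial segment of the operator sequence
(`e_i` applied `ki` times, then `e_j` applied `ki+kj` times, then `e_i` applied
`kj` times). -/
def alongPath (n i j ki kj : ℕ) (β γ : KPf) : Prop :=
  (∃ a ≤ ki, iterO (eop n i) a β = some γ) ∨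
  (∃ b ≤ ki + kj, (iterO (eop n i) ki β).bind (iterO (eop n j) b) = some γ) ∨
  (∃ c ≤ kj, ((iterO (eop n i) ki β).bind (iterO (eop n j) (ki + kj))).bind
      (iterO (eop n i) c) = some γ)

/-- Conjecture A: no broken diamonds along the hexagon paths. -/
def ConjA (n : ℕ) (lam mu : ℕ → ℤ) : Prop :=
  ∀ (w : Equiv.Perm (Fin n)) (β : KPf) (i j : ℕ),
    InS n lam mu w β → 1 ≤ i → i ≤ n - 1 → 1 ≤ j → j ≤ n - 1 → (j = i + 1 ∨ i = j + 1) →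
    ∀ ki kj : ℤ,
      ki = pairCo (permAct n w (lamRho n lam)) i →
      kj = pairCo (permAct n w (lamRho n lam)) j →
      0 < ki → 0 < kj →
      iterO (eop n i) ki.toNat β ≠ none → iterO (eop n j) kj.toNat β ≠ none →
      ∀ γ : KPf,
        (alongPath n i j ki.toNat kj.toNat β γ ∨ alongPath n j i kj.toNat ki.toNat β γ) →
        ¬ (simZero2 n i j γ ∧ simZero2 n j i γ)

/-- Conjecture B: broken hexagons propagate up to the source vertex. -/
def ConjB (n : ℕ) (lam mu : ℕ → ℤ) : Prop :=
  ∀ (w : Equiv.Perm (Fin n)) (β α : KPf) (i j : ℕ),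
    InS n lam mu w β → InS n lam mu 1 α → Conn n lam mu (1, α) (w, β) →
    BrokenHexAt n lam mu w β i j → ∃ j', BrokenHexAt n lam mu 1 α i j'

/-- The Kostka–Foulkes polynomial `K_{λ,μ}(t) = Σ_{(w,α) ∈ S_{λ,μ}} sgn(w) t^{|α|}`. -/
noncomputable def KF (n : ℕ) (lam mu : ℕ → ℤ) : Polynomial ℤ :=
  ∑ᶠ (w : Equiv.Perm (Fin n)) (α : KPf) (_ : InS n lam mu w α),
    ((Equiv.Perm.sign w : ℤ) • (Polynomial.X ^ kpSize n α) : Polynomial ℤ)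

end KFC

namespace KFC

/-- A block of a tensor product of type `A₂` crystals: a one-row element of a symmetric power of
the vector representation (`ty = true`) or of its dual (`ty = false`), recorded by the
multiplicities of its three letters. -/
structure Block where
  ty : Bool
  x : ℕ
  y : ℕ
  z : ℕ

namespace Block

/-- Number of plus signs in the signature of a block. -/
def phi (o : Bool) (b : Block) : ℕ := if o = b.ty then b.x else b.y

/-- Number of minus signs in the signature of a block. -/
def eps (o : Bool) (b : Block) : ℕ := if o = b.ty then b.y else b.z

/-- The lowering operator on a block. -/
def lower (o : Bool) (b : Block) : Block :=
  if o = b.ty then ⟨b.ty, b.x - 1, b.y + 1, b.z⟩ else ⟨b.ty, b.x, b.y - 1, b.z + 1⟩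

/-- `ε` of a tensor product; the head of the list is the rightmost factor. -/
def epsL (o : Bool) : List Block → ℕ
  | [] => 0
  | b :: l => b.eps o + (epsL o l - b.phi o)

/-- `φ` of a tensor product. -/
def phiL (o : Bool) : List Block → ℕ
  | [] => 0
  | b :: l => phiL o l + (b.phi o - epsL o l)

/-- The lowering operator on a tensor product, following the signature rule. -/
def lowerL (o : Bool) : List Block → Option (List Block)
  | [] => none
  | b :: l =>
    if epsL o l < b.phi o then some (b.lower o :: l) else (lowerL o l).map (b :: ·)

end Block

/-- Lusztig data `(n₁, n₁₂, n₂)` of an element of the crystal `B(∞)` of type `A₂`. -/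
abbrev Lus : Type := ℕ × ℕ × ℕ

namespace Lus

/-- The lowering operators of `B(∞)`. -/
def lower : Bool → Lus → Lus
  | true, (a, b, c) => (a + 1, b, c)
  | false, (a, b, c) => if c < a then (a - 1, b + 1, c) else (a, b, c + 1)

/-- The functions `ε` of `B(∞)`. -/
def eps : Bool → Lus → ℕ
  | true, (a, _, _) => a
  | false, (a, b, c) => b + (c - a)

/-- Change of Lusztig data between the two reduced words of the longest element. -/
def swap : Lus → Lus
  | (a, b, c) => (b + c - min a c, min a c, a + b - min a c)

theorem swap_swap (l : Lus) : swap (swap l) = l := by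
  obtain ⟨a, b, c⟩ := l
  simp only [swap, Prod.mk.injEq]
  omega

theorem eps_swap (o : Bool) (l : Lus) : eps o (swap l) = eps (!o) l := by
  obtain ⟨a, b, c⟩ := l
  cases o <;> simp only [swap, eps, Bool.not_true, Bool.not_false] <;> omega

theorem lower_false_of_lt {a b c : ℕ} (h : c < a) :
    lower false (a, b, c) = (a - 1, b + 1, c) := if_pos h

theorem lower_false_of_le {a b c : ℕ} (h : a ≤ c) :
    lower false (a, b, c) = (a, b, c + 1) := if_neg h.not_gt

theorem lower_swap (o : Bool) (l : Lus) : lower o (swap l) = swap (lower (!o) l) := by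
  obtain ⟨a, b, c⟩ := l
  cases o
  · change lower false (_, _, _) = swap (a + 1, b, c)
    rcases lt_or_ge a c with h | h
    · rw [lower_false_of_lt (by omega)]
      simp only [swap, Prod.mk.injEq]
      omega
    · rw [lower_false_of_le (by omega)]
      simp only [swap, Prod.mk.injEq]
      omega
  · change (_ + 1, _, _) = swap (lower false (a, b, c))
    rcases lt_or_ge c a with h | h
    · rw [lower_false_of_lt h]
      simp only [swap, Prod.mk.injEq]
      omega
    · rw [lower_false_of_le h]
      simp only [swap, Prod.mk.injEq]
      omega

/-- The isomorphism of `B(∞) ⊗ Symᵏ V` with a disjoint union of copies of `B(∞)`, the second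
component recording the copy. -/
def insV (x y z : ℕ) : Lus → Lus × (ℕ × ℕ × ℕ)
  | (a, b, c) =>
    ((a - min x a + y, b - min b (x - min x a + y) + z,
        c - min (min x a) c + min b (x - min x a + y)),
      (x + y + z - min x a - min b (x - min x a + y),
        min x a - min (min x a) c + min b (x - min x a + y), min (min x a) c))

theorem insV_cases (x y z a b c : ℕ) :
    ∃ s t r, (s = x ∧ x ≤ a ∨ s = a ∧ a < x) ∧ (t = s ∧ s ≤ c ∨ t = c ∧ c < s) ∧
      (r = b ∧ b + s ≤ x + y ∨ r + s = x + y ∧ x + y < b + s) ∧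
      insV x y z (a, b, c) =
        ((a - s + y, b - r + z, c - t + r), (x + y + z - s - r, s - t + r, t)) := by
  refine ⟨min x a, min (min x a) c, min b (x - min x a + y), ?_, ?_, ?_, rfl⟩ <;> omega

/-- The inverse of `insV`. -/
def extV : Lus × (ℕ × ℕ × ℕ) → (ℕ × ℕ × ℕ) × Lus
  | ((a, b, c), (t₁, t₂, t₃)) =>
    let z := min t₁ b
    let y₁ := min (t₁ - z) a
    let y₂ := min t₂ (min (a - y₁) c)
    let r := min (t₂ - y₂) (c - y₂)
    ((t₁ - z - y₁ + (t₂ - y₂) + t₃, y₁ + y₂, z),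
      (a - y₁ - y₂ + (t₂ - y₂ - r) + t₃, b - z + y₂ + r, c - y₂ - r + t₃))

theorem extV_insV (x y z : ℕ) (l : Lus) : extV (insV x y z l) = ((x, y, z), l) := by
  obtain ⟨a, b, c⟩ := l
  obtain ⟨s, t, r, hs, ht, hr, e⟩ := insV_cases x y z a b c
  rw [e]
  have hz : min (x + y + z - s - r) (b - r + z) = z := by omega
  obtain ⟨y₁, hy₁⟩ : ∃ y₁, y₁ = min (x + y + z - s - r - z) (a - s + y) := ⟨_, rfl⟩
  have hy₁' : y₁ = min (x + y - s - r) y := by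
    rcases hs with hs | hs <;> omega
  have hy₂ : min (s - t + r) (min (a - s + y - y₁) (c - t + r)) = y - y₁ := by
    rcases hs with hs | hs <;> rcases ht with ht | ht <;> rcases hr with hr | hr <;> omega
  obtain ⟨u, hu⟩ : ∃ u, u = min (s - t + r - (y - y₁)) (c - t + r - (y - y₁)) := ⟨_, rfl⟩
  have hu' : u + y = y₁ + r := by
    rcases hs with hs | hs <;> rcases ht with ht | ht <;> rcases hr with hr | hr <;> omega
  simp only [extV, hz, ← hy₁, hy₂, ← hu, Prod.mk.injEq]
  clear hy₁ hy₂ hu hz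
  refine ⟨⟨?_, ?_, trivial⟩, ?_, ?_, ?_⟩ <;>
    rcases hs with hs | hs <;> rcases ht with ht | ht <;> rcases hr with hr | hr <;> omega

theorem insV_inj {x y z x' y' z' : ℕ} {l l' : Lus} (h : insV x y z l = insV x' y' z' l') :
    (x = x' ∧ y = y' ∧ z = z') ∧ l = l' := by
  have := congrArg extV h
  rw [extV_insV, extV_insV] at this
  simpa using this

theorem eps_insV_true (x y z : ℕ) (l : Lus) : eps true (insV x y z l).1 = y + (eps true l - x) := by
  obtain ⟨a, b, c⟩ := l
  simp only [insV, eps]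
  omega

theorem eps_insV_false (x y z : ℕ) (l : Lus) :
    eps false (insV x y z l).1 = z + (eps false l - y) := by
  obtain ⟨a, b, c⟩ := l
  obtain ⟨s, t, r, hs, ht, hr, e⟩ := insV_cases x y z a b c
  simp only [e, eps]
  rcases hs with hs | hs <;> rcases ht with ht | ht <;> rcases hr with hr | hr <;> omega

theorem insV_lower_block_true (x y z : ℕ) (l : Lus) (h : eps true l < x) :
    insV (x - 1) (y + 1) z l = (lower true (insV x y z l).1, (insV x y z l).2) := by
  obtain ⟨a, b, c⟩ := l
  obtain ⟨s, t, r, hs, ht, hr, e⟩ := insV_cases x y z a b c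
  obtain ⟨s', t', r', hs', ht', hr', e'⟩ := insV_cases (x - 1) (y + 1) z a b c
  rw [e, e']
  simp only [eps, lower, Prod.mk.injEq] at h ⊢
  rcases hs with hs | hs <;> rcases ht with ht | ht <;> rcases hr with hr | hr <;> omega

theorem insV_lower_block_false (x y z : ℕ) (l : Lus) (h : eps false l < y) :
    insV x (y - 1) (z + 1) l = (lower false (insV x y z l).1, (insV x y z l).2) := by
  obtain ⟨a, b, c⟩ := l
  obtain ⟨s, t, r, hs, ht, hr, e⟩ := insV_cases x y z a b c
  obtain ⟨s', t', r', hs', ht', hr', e'⟩ := insV_cases x (y - 1) (z + 1) a b c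
  rw [e, e']
  simp only [eps, lower] at h ⊢
  rcases hs with hs | hs <;> rcases ht with ht | ht <;> rcases hr with hr | hr <;>
    split_ifs <;> simp only [Prod.mk.injEq] <;> omega

theorem insV_lower_true (x y z : ℕ) (l : Lus) (h : x ≤ eps true l) :
    insV x y z (lower true l) = (lower true (insV x y z l).1, (insV x y z l).2) := by
  obtain ⟨a, b, c⟩ := l
  obtain ⟨s, t, r, hs, ht, hr, e⟩ := insV_cases x y z a b c
  obtain ⟨s', t', r', hs', ht', hr', e'⟩ := insV_cases x y z (a + 1) b c
  simp only [eps, lower] at h ⊢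
  rw [e, e']
  simp only [Prod.mk.injEq]
  rcases hs with hs | hs <;> rcases ht with ht | ht <;> rcases hr with hr | hr <;> omega

theorem insV_lower_false (x y z : ℕ) (l : Lus) (h : y ≤ eps false l) :
    insV x y z (lower false l) = (lower false (insV x y z l).1, (insV x y z l).2) := by
  obtain ⟨a, b, c⟩ := l
  obtain ⟨s, t, r, hs, ht, hr, e⟩ := insV_cases x y z a b c
  simp only [eps] at h
  rcases lt_or_ge c a with hca | hca
  · obtain ⟨s', t', r', hs', ht', hr', e'⟩ := insV_cases x y z (a - 1) (b + 1) c
    rw [lower_false_of_lt hca, e, e']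
    rcases lt_or_ge x a with hxa | hxa
    · obtain rfl : s = x := by omega
      obtain rfl : s' = s := by omega
      rw [lower_false_of_lt (by omega)]
      simp only [Prod.mk.injEq]
      rcases ht with ht | ht <;> rcases hr with hr | hr <;> omega
    · obtain rfl : s = a := by omega
      obtain rfl : t = c := by omega
      obtain rfl : s' = s - 1 := by omega
      obtain rfl : t' = t := by omega
      rw [lower_false_of_le (by omega)]
      simp only [Prod.mk.injEq, and_true]
      rcases hr with hr | hr <;> omega
  · obtain ⟨s', t', r', hs', ht', hr', e'⟩ := insV_cases x y z a b (c + 1)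
    rw [lower_false_of_le hca, e, e', lower_false_of_le]
    · simp only [Prod.mk.injEq]
      rcases ht with ht | ht <;> rcases hr with hr | hr <;> omega
    · rcases hs with hs | hs <;> rcases ht with ht | ht <;> rcases hr with hr | hr <;> omega

/-- Tensoring with a block on the right. -/
def ins (b : Block) (l : Lus) : Lus × (ℕ × ℕ × ℕ) :=
  if b.ty then insV b.x b.y b.z l
  else (swap (insV b.x b.y b.z (swap l)).1, (insV b.x b.y b.z (swap l)).2)

theorem ins_inj {b b' : Block} {l l' : Lus} (ht : b.ty = b'.ty) (h : ins b l = ins b' l') :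
    b = b' ∧ l = l' := by
  obtain ⟨t, x, y, z⟩ := b
  obtain ⟨t', x', y', z'⟩ := b'
  obtain rfl : t = t' := ht
  cases t
  · simp only [ins, Bool.false_eq_true, if_false, Prod.mk.injEq] at h
    have h1 := congrArg swap h.1
    rw [swap_swap, swap_swap] at h1
    obtain ⟨⟨rfl, rfl, rfl⟩, h2⟩ := insV_inj (Prod.ext h1 h.2)
    refine ⟨rfl, ?_⟩
    rw [← swap_swap l, h2, swap_swap]
  · simp only [ins, if_true] at h
    obtain ⟨⟨rfl, rfl, rfl⟩, h2⟩ := insV_inj h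
    exact ⟨rfl, h2⟩

theorem eps_ins (o : Bool) (b : Block) (l : Lus) :
    eps o (ins b l).1 = b.eps o + (eps o l - b.phi o) := by
  obtain ⟨t, x, y, z⟩ := b
  cases t <;> cases o <;>
    simp [ins, Block.eps, Block.phi, eps_swap, eps_insV_true, eps_insV_false]

theorem ins_lower_block (o : Bool) (b : Block) (l : Lus) (h : eps o l < b.phi o) :
    ins (b.lower o) l = (lower o (ins b l).1, (ins b l).2) := by
  obtain ⟨t, x, y, z⟩ := b
  cases t <;> cases o <;> simp [Block.phi] at h <;> simp [ins, Block.lower, lower_swap]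
  · rw [insV_lower_block_true _ _ _ _ (by simpa [eps_swap] using h)]
    simp
  · rw [insV_lower_block_false _ _ _ _ (by simpa [eps_swap] using h)]
    simp
  · exact insV_lower_block_false _ _ _ _ h
  · exact insV_lower_block_true _ _ _ _ h

theorem ins_lower (o : Bool) (b : Block) (l : Lus) (h : b.phi o ≤ eps o l) :
    ins b (lower o l) = (lower o (ins b l).1, (ins b l).2) := by
  obtain ⟨t, x, y, z⟩ := b
  have h' : lower (!o) (swap l) = swap (lower o l) := by simp [lower_swap]
  cases t <;> cases o <;> simp [Block.phi] at h <;> simp [ins, lower_swap] <;>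
    simp only [Bool.not_true, Bool.not_false] at h'
  · rw [← h', insV_lower_true _ _ _ _ (by simpa [eps_swap] using h)]
    simp
  · rw [← h', insV_lower_false _ _ _ _ (by simpa [eps_swap] using h)]
    simp
  · exact insV_lower_false _ _ _ _ h
  · exact insV_lower_true _ _ _ _ h

theorem iterate_lower_true (k a b c : ℕ) : (lower true)^[k] (a, b, c) = (a + k, b, c) := by
  induction k with
  | zero => rfl
  | succ k ih => rw [Function.iterate_succ_apply', ih]; rfl

theorem iterate_lower_false (k a b c : ℕ) :
    (lower false)^[k] (a, b, c) =
      (a - min k (a - c), b + min k (a - c), c + (k - min k (a - c))) := by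
  induction k with
  | zero => simp
  | succ k ih =>
    rw [Function.iterate_succ_apply', ih]
    simp only [lower]
    split_ifs <;> simp only [Prod.mk.injEq] <;> omega

/-- The Verma relation in `B(∞)`. -/
theorem verma (p q : ℕ) (l : Lus) :
    (lower true)^[q] ((lower false)^[p + q] ((lower true)^[p] l)) =
      (lower false)^[p] ((lower true)^[p + q] ((lower false)^[q] l)) := by
  obtain ⟨a, b, c⟩ := l
  simp only [iterate_lower_true, iterate_lower_false, Prod.mk.injEq]
  omega

end Lus

namespace Block

/-- The embedding of a tensor product of blocks into a disjoint union of copies of `B(∞)`. -/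
def toLus : List Block → Lus × List (Bool × ℕ × ℕ × ℕ)
  | [] => ((0, 0, 0), [])
  | b :: l => ((Lus.ins b (toLus l).1).1, (b.ty, (Lus.ins b (toLus l).1).2) :: (toLus l).2)

theorem toLus_injective : Function.Injective toLus := by
  intro l
  induction l with
  | nil => intro l' h; cases l' <;> simp_all [toLus]
  | cons b l ih =>
    intro l' h
    cases l' with
    | nil => simp [toLus] at h
    | cons b' l' =>
      simp only [toLus, Prod.mk.injEq, List.cons.injEq] at h
      obtain ⟨h1, ⟨ht, h2⟩, h3⟩ := h
      obtain ⟨rfl, h4⟩ := Lus.ins_inj ht (Prod.ext h1 h2)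
      rw [ih (Prod.ext h4 h3)]

theorem eps_toLus (o : Bool) (l : List Block) : Lus.eps o (toLus l).1 = epsL o l := by
  induction l with
  | nil => cases o <;> rfl
  | cons b l ih => rw [toLus, Lus.eps_ins, ih, epsL]

theorem toLus_lowerL {o : Bool} {l l' : List Block} (h : lowerL o l = some l') :
    toLus l' = (Lus.lower o (toLus l).1, (toLus l).2) := by
  induction l generalizing l' with
  | nil => simp [lowerL] at h
  | cons b l ih =>
    rw [lowerL] at h
    split_ifs at h with hb
    · obtain rfl := Option.some.inj h
      have := Lus.ins_lower_block o b (toLus l).1 (by rwa [eps_toLus])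
      have ht : (b.lower o).ty = b.ty := by unfold lower; split_ifs <;> rfl
      simp only [toLus, this, ht]
    · obtain ⟨m, hm, rfl⟩ := Option.map_eq_some_iff.1 h
      have := Lus.ins_lower o b (toLus l).1 (by rw [eps_toLus]; omega)
      simp only [toLus, ih hm, this]

theorem phi_lower_self {o : Bool} {b : Block} (h : 0 < b.phi o) :
    (b.lower o).phi o + 1 = b.phi o ∧ (b.lower o).eps o = b.eps o + 1 := by
  unfold phi lower eps at *
  split_ifs at * <;> simp_all <;> omega

theorem phi_lower_other {o : Bool} {b : Block} (h : 0 < b.phi o) :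
    (b.lower o).phi (!o) + b.eps (!o) = b.phi (!o) + (b.lower o).eps (!o) + 1 := by
  obtain ⟨t, x, y, z⟩ := b
  cases o <;> cases t <;> simp [phi, lower, eps] at * <;> omega

theorem epsL_phiL_lowerL_self {o : Bool} {l l' : List Block} (h : lowerL o l = some l') :
    epsL o l' = epsL o l + 1 ∧ phiL o l' + 1 = phiL o l := by
  induction l generalizing l' with
  | nil => simp [lowerL] at h
  | cons b l ih =>
    rw [lowerL] at h
    split_ifs at h with hb
    · obtain rfl := Option.some.inj h
      have := phi_lower_self (o := o) (b := b) (by omega)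
      simp only [epsL, phiL]
      omega
    · obtain ⟨m, hm, rfl⟩ := Option.map_eq_some_iff.1 h
      have := ih hm
      simp only [epsL, phiL]
      omega

theorem epsL_phiL_lowerL_other {o : Bool} {l l' : List Block} (h : lowerL o l = some l') :
    phiL (!o) l' + epsL (!o) l = phiL (!o) l + epsL (!o) l' + 1 := by
  induction l generalizing l' with
  | nil => simp [lowerL] at h
  | cons b l ih =>
    rw [lowerL] at h
    split_ifs at h with hb
    · obtain rfl := Option.some.inj h
      have := phi_lower_other (o := o) (b := b) (by omega)
      simp only [epsL, phiL]
      omega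
    · obtain ⟨m, hm, rfl⟩ := Option.map_eq_some_iff.1 h
      have := ih hm
      simp only [epsL, phiL]
      omega

end Block

theorem reduceW_append_singleton (w : List Entry) (e : Entry) :
    reduceW (w ++ [e]) = redStep (reduceW w) e := by
  simp [reduceW]

theorem redStep_false (s : List Entry) (r : Root) : redStep s (false, r) = s ++ [(false, r)] := rfl

theorem redStep_true_concat_false (s : List Entry) (r r' : Root) :
    redStep (s ++ [(false, r')]) (true, r) = s := by
  simp [redStep]

theorem redStep_true_of_forall {s : List Entry} (hs : ∀ e ∈ s, e.1 = true) (r : Root) :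
    redStep s (true, r) = s ++ [(true, r)] := by
  rcases List.eq_nil_or_concat s with rfl | ⟨s', ⟨b, r'⟩, rfl⟩
  · rfl
  · obtain rfl : b = true := hs (b, r') (by simp)
    simp [redStep]

/-- A reduced word consists of plus signs followed by minus signs. -/
theorem exists_reduceW_eq (w : List Entry) : ∃ P M : List Entry,
    reduceW w = P ++ M ∧ (∀ e ∈ P, e.1 = true) ∧ ∀ e ∈ M, e.1 = false := by
  induction w using List.reverseRecOn with
  | nil => exact ⟨[], [], rfl, by simp, by simp⟩
  | append_singleton w e ih =>
    obtain ⟨P, M, h, hP, hM⟩ := ih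
    obtain ⟨b, r⟩ := e
    rw [reduceW_append_singleton, h]
    cases b
    · refine ⟨P, M ++ [(false, r)], by simp [redStep_false], hP, ?_⟩
      intro e he
      rcases List.mem_append.1 he with he | he
      · exact hM e he
      · simp_all
    · rcases List.eq_nil_or_concat M with rfl | ⟨M', ⟨b, r'⟩, rfl⟩
      · refine ⟨P ++ [(true, r)], [], ?_, ?_, by simp⟩
        · rw [List.append_nil, redStep_true_of_forall hP, List.append_nil]
        · intro e he
          rcases List.mem_append.1 he with he | he
          · exact hP e he
          · simp_all
      · obtain rfl : b = false := hM (b, r') (by simp)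
        refine ⟨P, M', ?_, hP, fun e he => hM e (by simp [he])⟩
        rw [List.concat_eq_append, ← List.append_assoc, redStep_true_concat_false]

theorem filter_plus_eq {P M : List Entry} (hP : ∀ e ∈ P, e.1 = true) (hM : ∀ e ∈ M, e.1 = false) :
    (P ++ M).filter (fun e => e.1) = P ∧ (P ++ M).filter (fun e => !e.1) = M := by
  rw [List.filter_append, List.filter_append]
  constructor
  · rw [List.filter_eq_self.2 hP, List.filter_eq_nil_iff.2 (by simpa using hM), List.append_nil]
  · rw [List.filter_eq_nil_iff.2 (by simpa using hP), List.filter_eq_self.2 (by simpa using hM),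
      List.nil_append]

theorem reduceW_concat_false (w : List Entry) (r : Root) :
    plusCt (reduceW (w ++ [(false, r)])) = plusCt (reduceW w) ∧
      minusCt (reduceW (w ++ [(false, r)])) = minusCt (reduceW w) + 1 ∧
      lastPlus (w ++ [(false, r)]) = lastPlus w := by
  simp [lastPlus, reduceW_append_singleton, redStep_false, plusCt, minusCt]

theorem reduceW_concat_true_of_pos {w : List Entry} (h : 0 < minusCt (reduceW w)) (r : Root) :
    plusCt (reduceW (w ++ [(true, r)])) = plusCt (reduceW w) ∧
      minusCt (reduceW (w ++ [(true, r)])) + 1 = minusCt (reduceW w) ∧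
      lastPlus (w ++ [(true, r)]) = lastPlus w := by
  obtain ⟨P, M, hw, hP, hM⟩ := exists_reduceW_eq w
  simp only [lastPlus, reduceW_append_singleton, plusCt, minusCt] at h ⊢
  rw [hw] at h ⊢
  rcases List.eq_nil_or_concat M with rfl | ⟨M', ⟨b, r'⟩, rfl⟩
  · rw [(filter_plus_eq hP hM).2] at h
    simp at h
  · obtain rfl : b = false := hM (b, r') (by simp)
    rw [List.concat_eq_append, ← List.append_assoc, redStep_true_concat_false]
    simp [add_assoc]

theorem reduceW_concat_true_of_zero {w : List Entry} (h : minusCt (reduceW w) = 0) (r : Root) :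
    plusCt (reduceW (w ++ [(true, r)])) = plusCt (reduceW w) + 1 ∧
      minusCt (reduceW (w ++ [(true, r)])) = 0 ∧
      lastPlus (w ++ [(true, r)]) = some r := by
  obtain ⟨P, M, hw, hP, hM⟩ := exists_reduceW_eq w
  simp only [lastPlus, reduceW_append_singleton, plusCt, minusCt] at h ⊢
  rw [hw] at h ⊢
  rw [(filter_plus_eq hP hM).2, List.length_eq_zero_iff] at h
  subst h
  rw [List.append_nil, redStep_true_of_forall hP]
  have := filter_plus_eq hP hM
  rw [List.append_nil] at this
  simp [this.1, this.2]

theorem reduceW_append (w w' : List Entry) :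
    plusCt (reduceW (w ++ w')) =
        plusCt (reduceW w) + (plusCt (reduceW w') - minusCt (reduceW w)) ∧
      minusCt (reduceW (w ++ w')) =
        minusCt (reduceW w') + (minusCt (reduceW w) - plusCt (reduceW w')) ∧
      lastPlus (w ++ w') =
        if minusCt (reduceW w) < plusCt (reduceW w') then lastPlus w' else lastPlus w := by
  induction w' using List.reverseRecOn with
  | nil => simp [reduceW, plusCt, minusCt]
  | append_singleton w' e ih =>
    obtain ⟨b, r⟩ := e
    obtain ⟨h1, h2, h3⟩ := ih
    rw [← List.append_assoc]
    cases b
    · obtain ⟨a1, a2, a3⟩ := reduceW_concat_false (w ++ w') r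
      obtain ⟨b1, b2, b3⟩ := reduceW_concat_false w' r
      rw [a1, a2, a3, b1, b2, b3, h1, h2, h3]
      exact ⟨rfl, by omega, rfl⟩
    · rcases Nat.eq_zero_or_pos (minusCt (reduceW (w ++ w'))) with h0 | h0
      · obtain ⟨a1, a2, a3⟩ := reduceW_concat_true_of_zero h0 r
        obtain ⟨b1, b2, b3⟩ := reduceW_concat_true_of_zero (w := w') (by omega) r
        rw [a1, a2, a3, b1, b2, b3, h1, if_pos (by omega)]
        exact ⟨by omega, by omega, rfl⟩
      · obtain ⟨a1, a2, a3⟩ := reduceW_concat_true_of_pos h0 r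
        rcases Nat.eq_zero_or_pos (minusCt (reduceW w')) with h0' | h0'
        · obtain ⟨b1, b2, b3⟩ := reduceW_concat_true_of_zero h0' r
          rw [a1, a3, b1, b2, h1, h3, if_neg (by omega), if_neg (by omega)]
          exact ⟨by omega, by omega, rfl⟩
        · obtain ⟨b1, b2, b3⟩ := reduceW_concat_true_of_pos h0' r
          rw [a1, a3, b1, b3, h1, h3]
          exact ⟨rfl, by omega, rfl⟩

theorem reduceW_replicate_true (k : ℕ) (r : Root) :
    plusCt (reduceW (List.replicate k (true, r))) = k ∧
      minusCt (reduceW (List.replicate k (true, r))) = 0 ∧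
      lastPlus (List.replicate k (true, r)) = if 0 < k then some r else none := by
  induction k with
  | zero => simp [reduceW, plusCt, minusCt, lastPlus]
  | succ k ih =>
    rw [List.replicate_succ']
    obtain ⟨a1, a2, a3⟩ := reduceW_concat_true_of_zero ih.2.1 r
    simp [a1, a2, a3, ih.1]

theorem reduceW_replicate_false (k : ℕ) (r : Root) :
    plusCt (reduceW (List.replicate k (false, r))) = 0 ∧
      minusCt (reduceW (List.replicate k (false, r))) = k ∧
      lastPlus (List.replicate k (false, r)) = none := by
  induction k with
  | zero => simp [reduceW, plusCt, minusCt, lastPlus]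
  | succ k ih =>
    rw [List.replicate_succ']
    obtain ⟨a1, a2, a3⟩ := reduceW_concat_false (List.replicate k (false, r)) r
    simp [a1, a2, a3, ih]

theorem lastPlus_eq_none_iff (w : List Entry) : lastPlus w = none ↔ plusCt (reduceW w) = 0 := by
  simp [lastPlus, plusCt]

theorem mem_of_mem_reduceW {w : List Entry} {e : Entry} (h : e ∈ reduceW w) : e ∈ w := by
  induction w using List.reverseRecOn with
  | nil => simp [reduceW] at h
  | append_singleton w e' ih =>
    rw [reduceW_append_singleton] at h
    unfold redStep at h
    split at h
    · exact List.mem_append_left _ (ih (List.mem_of_mem_dropLast h))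
    · rcases List.mem_append.1 h with h | h
      · exact List.mem_append_left _ (ih h)
      · exact List.mem_append_right _ h

theorem mem_of_lastPlus {w : List Entry} {r : Root} (h : lastPlus w = some r) :
    (true, r) ∈ w := by
  obtain ⟨⟨b, r'⟩, h1, rfl⟩ := Option.map_eq_some_iff.1 h
  have h2 := List.mem_of_getLast? h1
  obtain ⟨h3, h4⟩ := List.mem_filter.1 h2
  obtain rfl : b = true := h4
  exact mem_of_mem_reduceW h3

theorem plusCt_sub_minusCt_reduceW (w : List Entry) :
    (plusCt (reduceW w) : ℤ) - minusCt (reduceW w) = plusCt w - minusCt w := by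
  induction w using List.reverseRecOn with
  | nil => rfl
  | append_singleton w e ih =>
    obtain ⟨b, r⟩ := e
    have hp : ∀ w', plusCt (w ++ w') = plusCt w + plusCt w' := by simp [plusCt]
    have hm : ∀ w', minusCt (w ++ w') = minusCt w + minusCt w' := by simp [minusCt]
    rw [hp, hm]
    cases b
    · obtain ⟨a1, a2, -⟩ := reduceW_concat_false w r
      have e1 : plusCt [((false, r) : Entry)] = 0 := rfl
      have e2 : minusCt [((false, r) : Entry)] = 1 := rfl
      omega
    · have e1 : plusCt [((true, r) : Entry)] = 1 := rfl
      have e2 : minusCt [((true, r) : Entry)] = 0 := rfl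
      rcases Nat.eq_zero_or_pos (minusCt (reduceW w)) with h0 | h0
      · obtain ⟨a1, a2, -⟩ := reduceW_concat_true_of_zero h0 r
        omega
      · obtain ⟨a1, a2, -⟩ := reduceW_concat_true_of_pos h0 r
        omega

/-- The root replacing `r` when `f_i` acts on the plus sign under `r`. -/
def raise (i : ℕ) (r : Root) : Root := if r.2 = i then (r.1, i + 1) else (i, r.2)

theorem mem_Wword_true {n i : ℕ} {α : KPf} {r : Root} (h : (true, r) ∈ Wword n i α) :
    r.2 = i ∧ 0 < α r := by
  simp only [Wword, List.mem_flatMap, List.mem_append, List.mem_replicate, Prod.mk.injEq] at h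
  obtain ⟨a, -, ⟨h, -, rfl⟩ | ⟨-, h, -⟩⟩ := h
  · exact ⟨rfl, Nat.pos_of_ne_zero h⟩
  · simp at h

theorem mem_Wstar_true {n i : ℕ} {α : KPf} {r : Root} (h : (true, r) ∈ Wstar n i α) :
    r.1 = i + 1 ∧ 0 < α r := by
  simp only [Wstar, List.mem_flatMap, List.mem_append, List.mem_replicate, Prod.mk.injEq] at h
  obtain ⟨a, -, ⟨h, -, rfl⟩ | ⟨-, h, -⟩⟩ := h
  · exact ⟨rfl, Nat.pos_of_ne_zero h⟩
  · simp at h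

/-- The operator `f_i` follows the signature rule for the word `W_i* W_i`. -/
theorem fop_eq {n i : ℕ} {α : KPf} (hα : IsKP n α) :
    fop n i α =
      (lastPlus (Wstar n i α ++ Wword n i α)).map (fun r => KPmove α r (raise i r)) := by
  obtain ⟨-, -, h⟩ := reduceW_append (Wstar n i α) (Wword n i α)
  rw [h]
  unfold fop bStar aSt aStar
  split_ifs with h1 h2
  · unfold ftilde
    cases h3 : lastPlus (Wword n i α) with
    | none => rw [lastPlus_eq_none_iff] at h3; omega
    | some r => simp [raise, (mem_Wword_true (mem_of_lastPlus h3)).1]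
  · unfold ftildeS
    cases h3 : lastPlus (Wstar n i α) with
    | none => rw [lastPlus_eq_none_iff] at h3; omega
    | some r =>
      obtain ⟨h4, h5⟩ := mem_Wstar_true (mem_of_lastPlus h3)
      have := (hα r h5.ne').2.1
      simp [raise, show r.2 ≠ i by omega]
  · rw [(lastPlus_eq_none_iff _).2 (by omega), Option.map_none]

/-- The tensor product `B` of blocks attached to Kostant partitions matches the signed word `w` of
`α`, the root under the rightmost surviving plus sign satisfying `Q`. -/
def Linked (o : Bool) (i : ℕ) (α : KPf) (w : List Entry) (B : KPf → List Block)
    (Q : Root → Prop) : Prop :=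
  Block.epsL o (B α) = minusCt (reduceW w) ∧ Block.phiL o (B α) = plusCt (reduceW w) ∧
    ∀ r, lastPlus w = some r →
      Q r ∧ Block.lowerL o (B α) = some (B (KPmove α r (raise i r)))

theorem linked_nil (o : Bool) (i : ℕ) (α : KPf) :
    Linked o i α [] (fun _ => []) (fun _ => False) := by
  simp [Linked, Block.epsL, Block.phiL, reduceW, minusCt, plusCt, lastPlus]

theorem Linked.cons {o : Bool} {i : ℕ} {α : KPf} {w w' : List Entry} {B : KPf → List Block}
    {C : KPf → Block} {Q Q' : Root → Prop} (h : Linked o i α w B Q)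
    (hp : plusCt (reduceW w') = (C α).phi o) (hm : minusCt (reduceW w') = (C α).eps o)
    (hl : ∀ r, lastPlus w' = some r → Q' r)
    (hC : ∀ r, Q r → C (KPmove α r (raise i r)) = C α)
    (hC' : ∀ r, Q' r → C (KPmove α r (raise i r)) = (C α).lower o)
    (hB : ∀ r, Q' r → B (KPmove α r (raise i r)) = B α) :
    Linked o i α (w ++ w') (fun β => C β :: B β) (fun r => Q r ∨ Q' r) := by
  obtain ⟨h1, h2, h3⟩ := h
  obtain ⟨a1, a2, a3⟩ := reduceW_append w w'
  refine ⟨?_, ?_, ?_⟩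
  · rw [Block.epsL, a2, h1, hp, hm]
  · rw [Block.phiL, a1, h1, h2, hp]
  · intro r hr
    rw [a3, hp, ← h1] at hr
    rw [Block.lowerL]
    split_ifs at hr ⊢
    · have := hl r hr
      exact ⟨Or.inr this, by simp only [hC' r this, hB r this]⟩
    · obtain ⟨b1, b2⟩ := h3 r hr
      exact ⟨Or.inl b1, by simp only [b2, hC r b1, Option.map_some]⟩

theorem reduceW_plus_minus (a b : ℕ) (r r' : Root) :
    plusCt (reduceW (List.replicate a (true, r) ++ List.replicate b (false, r'))) = a ∧
      minusCt (reduceW (List.replicate a (true, r) ++ List.replicate b (false, r'))) = b ∧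
      ∀ s, lastPlus (List.replicate a (true, r) ++ List.replicate b (false, r')) = some s →
        s = r ∧ 0 < a := by
  obtain ⟨h1, h2, h3⟩ :=
    reduceW_append (List.replicate a (true, r)) (List.replicate b (false, r'))
  obtain ⟨a1, a2, a3⟩ := reduceW_replicate_true a r
  obtain ⟨b1, b2, b3⟩ := reduceW_replicate_false b r'
  rw [h1, h2, h3, a1, a2, b1, b2, a3]
  refine ⟨by omega, by omega, fun s hs => ?_⟩
  rw [if_neg (by omega)] at hs
  split_ifs at hs with h
  exact ⟨(Option.some.inj hs).symm, h⟩

theorem reduceW_minus_plus_minus (a b c : ℕ) (r r' r'' : Root) :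
    let w := List.replicate a ((false, r) : Entry) ++
      (List.replicate b (true, r') ++ List.replicate c (false, r''))
    plusCt (reduceW w) = b - a ∧ minusCt (reduceW w) = c + (a - b) ∧
      ∀ s, lastPlus w = some s → s = r' ∧ a < b := by
  intro w
  obtain ⟨h1, h2, h3⟩ := reduceW_append (List.replicate a ((false, r) : Entry))
    (List.replicate b (true, r') ++ List.replicate c (false, r''))
  obtain ⟨a1, a2, a3⟩ := reduceW_plus_minus b c r' r''
  obtain ⟨b1, b2, b3⟩ := reduceW_replicate_false a r
  rw [h1, h2, h3, b1, b2, b3, a1, a2]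
  refine ⟨by omega, by omega, fun s hs => ?_⟩
  split_ifs at hs with h
  exact ⟨(a3 s hs).1, h⟩

theorem Linked.append {o : Bool} {i : ℕ} {α : KPf} {w : List Entry} {B : KPf → List Block}
    {Q : Root → Prop} (h : Linked o i α w B Q) (C : KPf → ℕ → Block) (p m : ℕ → Root)
    (L : List ℕ) (hL : L.Nodup)
    (hp : ∀ a ∈ L, (C α a).phi o = α (p a)) (hm : ∀ a ∈ L, (C α a).eps o = α (m a))
    (hQ : ∀ r, Q r → ∀ a ∈ L, C (KPmove α r (raise i r)) a = C α a)
    (hB : ∀ a ∈ L, 0 < α (p a) → B (KPmove α (p a) (raise i (p a))) = B α)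
    (hC : ∀ a ∈ L, 0 < α (p a) → C (KPmove α (p a) (raise i (p a))) a = (C α a).lower o)
    (hC' : ∀ a ∈ L, ∀ b ∈ L, a ≠ b → C (KPmove α (p a) (raise i (p a))) b = C α b) :
    Linked o i α
      (w ++ L.flatMap (fun a => List.replicate (α (p a)) ((true, p a) : Entry) ++
        List.replicate (α (m a)) ((false, m a) : Entry)))
      (fun β => L.reverse.map (C β) ++ B β) (fun r => Q r ∨ ∃ a ∈ L, r = p a ∧ 0 < α r) := by
  induction L using List.reverseRecOn with
  | nil => simpa using h
  | append_singleton L a ih =>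
    have hL' := List.nodup_append.1 hL
    have ha : a ∉ L := fun ha => hL'.2.2 a ha a (by simp) rfl
    have ih := ih hL'.1 (fun b hb => hp b (by simp [hb])) (fun b hb => hm b (by simp [hb]))
      (fun r hr b hb => hQ r hr b (by simp [hb])) (fun b hb => hB b (by simp [hb]))
      (fun b hb => hC b (by simp [hb]))
      (fun b hb c hc => hC' b (by simp [hb]) c (by simp [hc]))
    obtain ⟨a1, a2, a3⟩ := reduceW_plus_minus (α (p a)) (α (m a)) (p a) (m a)
    have haL : a ∈ L ++ [a] := by simp
    have := ih.cons (C := fun β => C β a) (Q' := fun r => r = p a ∧ 0 < α (p a))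
      (a1.trans (hp a haL).symm) (a2.trans (hm a haL).symm) a3 ?_ ?_ ?_
    · rw [List.flatMap_append, ← List.append_assoc]
      simp only [List.flatMap_cons, List.flatMap_nil, List.append_nil, List.reverse_append,
        List.reverse_cons, List.reverse_nil, List.nil_append, List.map_cons,
        List.cons_append]
      obtain ⟨b1, b2, b3⟩ := this
      refine ⟨b1, b2, fun r hr => ⟨?_, (b3 r hr).2⟩⟩
      rcases (b3 r hr).1 with (hr | ⟨b, hb, hr⟩) | ⟨rfl, hr'⟩
      · exact Or.inl hr
      · exact Or.inr ⟨b, by simp [hb], hr⟩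
      · exact Or.inr ⟨a, haL, rfl, hr'⟩
    · rintro r (hr | ⟨b, hb, rfl, -⟩)
      · exact hQ r hr a haL
      · exact hC' b (by simp [hb]) a haL (fun e => ha (e ▸ hb))
    · rintro r ⟨rfl, hr⟩
      exact hC a haL hr
    · rintro r ⟨rfl, hr⟩
      rw [hB a haL hr]
      congr 1
      refine List.map_congr_left fun b hb => hC' a haL b ?_ ?_
      · simp [List.mem_reverse.1 hb]
      · rintro rfl
        exact ha (List.mem_reverse.1 hb)

theorem KPmove_apply (α : KPf) (r r' p : Root) :
    KPmove α r r' p =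
      if p = r' then (if p = r then α p - 1 else α p) + 1 else if p = r then α p - 1 else α p :=
  rfl

/-- The block of a row `h` below the base index. -/
def rowBlock (k : ℕ) (α : KPf) (h : ℕ) : Block := ⟨true, α (h, k), α (h, k + 1), α (h, k + 2)⟩

/-- The block of a column `j` beyond the base index. -/
def colBlock (k : ℕ) (α : KPf) (j : ℕ) : Block := ⟨false, α (k + 2, j), α (k + 1, j), α (k, j)⟩

/-- The number of disjoint pairs of adjacent simple roots at the base index. -/
def pairs (k : ℕ) (α : KPf) : ℕ := min (α (k, k + 1)) (α (k + 1, k + 2))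

/-- The rightmost of the four blocks recording the roots supported on the base indices. -/
def innerBlock₁ (k : ℕ) (α : KPf) : Block :=
  ⟨false, 0, α (k + 1, k + 2) - pairs k α, α (k, k + 2) + (α (k, k + 1) - pairs k α)⟩

/-- The second of the blocks recording the roots supported on the base indices. -/
def innerBlock₂ (k : ℕ) (α : KPf) : Block := ⟨true, 0, 0, pairs k α⟩

/-- The third of the blocks recording the roots supported on the base indices. -/
def innerBlock₃ (k : ℕ) (α : KPf) : Block := ⟨false, 0, 0, pairs k α⟩

/-- The leftmost of the blocks recording the roots supported on the base indices. -/
def innerBlock₄ (k : ℕ) (α : KPf) : Block :=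
  ⟨true, 0, α (k, k + 1) - pairs k α, α (k, k + 2) + (α (k + 1, k + 2) - pairs k α)⟩

/-- The tensor product of blocks attached to a Kostant partition, for the pair of consecutive
indices `k` and `k + 1`. -/
def blocks (n k : ℕ) (α : KPf) : List Block :=
  (List.range k).reverse.reverse.map (rowBlock k α) ++ innerBlock₄ k α :: innerBlock₃ k α ::
    ((List.range' (k + 3) (n - k - 2)).reverse.map (colBlock k α) ++
      [innerBlock₂ k α, innerBlock₁ k α])

theorem flatMap_eq_nil_of {L : List ℕ} {f : ℕ → List Entry} (h : ∀ a ∈ L, f a = []) :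
    L.flatMap f = [] := by
  simpa using h

theorem range_succ_split {n k : ℕ} (h : k + 2 ≤ n) :
    List.range (n + 1) =
      List.range (k + 1) ++ (k + 1) :: (k + 2) :: List.range' (k + 3) (n - k - 2) := by
  rw [List.range_eq_range', List.range_eq_range']
  change _ = _ ++ List.range' (k + 1) (n - k - 2 + 1 + 1)
  have := @List.range'_append_1 0 (k + 1) (n - k - 2 + 1 + 1)
  rw [zero_add] at this
  rw [this]
  congr 1
  omega

theorem range_reverse_split {n k : ℕ} (h : k ≤ n) :
    (List.range (n + 1)).reverse =
      (List.range' (k + 1) (n - k)).reverse ++ k :: (List.range k).reverse := by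
  rw [List.range_eq_range', List.range_eq_range']
  have h1 := @List.range'_append_1 0 (k + 1) (n - k)
  have h2 := @List.range'_concat 1 0 k
  rw [zero_add] at h1
  rw [show n + 1 = k + 1 + (n - k) by omega, ← h1, List.reverse_append, h2]
  simp

theorem IsKP.eq_zero {n : ℕ} {α : KPf} (hα : IsKP n α) {a b : ℕ} (h : b ≤ a) : α (a, b) = 0 := by
  by_contra h0
  have := (hα _ h0).2.1
  simp only at this
  omega

theorem Wstar_eq {n k : ℕ} {α : KPf} (hα : IsKP n α) (h : k + 2 ≤ n) :
    Wstar n k α = List.replicate (α (k, k + 1)) (false, (k, k + 1)) ++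
      (List.replicate (α (k + 1, k + 2)) (true, (k + 1, k + 2)) ++
        List.replicate (α (k, k + 2)) (false, (k, k + 2))) ++
      (List.range' (k + 3) (n - k - 2)).flatMap (fun j =>
        List.replicate (α (k + 1, j)) ((true, (k + 1, j)) : Entry) ++
        List.replicate (α (k, j)) ((false, (k, j)) : Entry)) := by
  rw [Wstar, range_succ_split h, List.flatMap_append, flatMap_eq_nil_of]
  · simp [hα.eq_zero le_rfl]
  · intro a ha
    have := List.mem_range.1 ha
    simp [hα.eq_zero (show a ≤ k by omega), hα.eq_zero (show a ≤ k + 1 by omega)]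

theorem Wstar_succ_eq {n k : ℕ} {α : KPf} (hα : IsKP n α) (h : k + 2 ≤ n) :
    Wstar n (k + 1) α = List.replicate (α (k + 1, k + 2)) (false, (k + 1, k + 2)) ++
      (List.range' (k + 3) (n - k - 2)).flatMap (fun j =>
        List.replicate (α (k + 2, j)) ((true, (k + 2, j)) : Entry) ++
        List.replicate (α (k + 1, j)) ((false, (k + 1, j)) : Entry)) := by
  rw [Wstar, range_succ_split h, List.flatMap_append, flatMap_eq_nil_of]
  · simp [hα.eq_zero le_rfl, hα.eq_zero (show k + 1 ≤ k + 2 by omega)]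
  · intro a ha
    have := List.mem_range.1 ha
    simp [hα.eq_zero (show a ≤ k + 1 by omega), hα.eq_zero (show a ≤ k + 1 + 1 by omega)]

theorem Wword_eq {n k : ℕ} {α : KPf} (hα : IsKP n α) (h : k ≤ n) :
    Wword n k α = List.replicate (α (k, k + 1)) (false, (k, k + 1)) ++
      (List.range k).reverse.flatMap (fun h =>
        List.replicate (α (h, k)) ((true, (h, k)) : Entry) ++
        List.replicate (α (h, k + 1)) ((false, (h, k + 1)) : Entry)) := by
  rw [Wword, range_reverse_split h, List.flatMap_append, flatMap_eq_nil_of]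
  · simp [hα.eq_zero le_rfl]
  · intro a ha
    have := (List.mem_range'_1.1 (List.mem_reverse.1 ha)).1
    simp [hα.eq_zero (show k ≤ a by omega), hα.eq_zero (show k + 1 ≤ a by omega)]

theorem Wword_succ_eq {n k : ℕ} {α : KPf} (hα : IsKP n α) (h : k + 1 ≤ n) :
    Wword n (k + 1) α = List.replicate (α (k + 1, k + 2)) (false, (k + 1, k + 2)) ++
      (List.replicate (α (k, k + 1)) (true, (k, k + 1)) ++
        List.replicate (α (k, k + 2)) (false, (k, k + 2))) ++
      (List.range k).reverse.flatMap (fun h =>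
        List.replicate (α (h, k + 1)) ((true, (h, k + 1)) : Entry) ++
        List.replicate (α (h, k + 2)) ((false, (h, k + 2)) : Entry)) := by
  rw [Wword_eq hα h, List.range_succ, List.reverse_append]
  simp

theorem linked_col {n k : ℕ} {α : KPf} (hα : IsKP n α) (h : k + 2 ≤ n) :
    Linked true k α (Wstar n k α)
      (fun β => (List.range' (k + 3) (n - k - 2)).reverse.map (colBlock k β) ++
        [innerBlock₂ k β, innerBlock₁ k β])
      (fun r => ((False ∨ r = (k + 1, k + 2) ∧ α (k, k + 1) < α (k + 1, k + 2)) ∨ False) ∨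
        ∃ j ∈ List.range' (k + 3) (n - k - 2), r = (k + 1, j) ∧ 0 < α r) := by
  rw [Wstar_eq hα h]
  obtain ⟨a1, a2, a3⟩ := reduceW_minus_plus_minus (α (k, k + 1)) (α (k + 1, k + 2))
    (α (k, k + 2)) (k, k + 1) (k + 1, k + 2) (k, k + 2)
  have h1 := (linked_nil true k α).cons (C := innerBlock₁ k)
    (Q' := fun r => r = (k + 1, k + 2) ∧ α (k, k + 1) < α (k + 1, k + 2))
    (by rw [a1]; simp [innerBlock₁, Block.phi, pairs]; omega)
    (by rw [a2]; simp [innerBlock₁, Block.eps, pairs]; omega) a3 (by simp)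
    (by
      rintro r ⟨rfl, hr⟩
      simp [raise, innerBlock₁, pairs, Block.lower, KPmove_apply]
      omega)
    (by simp)
  have h2 := h1.cons (C := innerBlock₂ k) (w' := []) (Q' := fun _ => False)
    (by simp [reduceW, plusCt, innerBlock₂, Block.phi])
    (by simp [reduceW, minusCt, innerBlock₂, Block.eps])
    (by simp [reduceW, lastPlus])
    (by
      rintro r (⟨⟨⟩⟩ | ⟨rfl, hr⟩)
      simp [raise, innerBlock₂, pairs, KPmove_apply]
      omega)
    (by simp) (by simp)
  rw [List.nil_append, List.append_nil] at h2
  refine h2.append (colBlock k) (fun j => (k + 1, j)) (fun j => (k, j)) _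
    List.nodup_range' ?_ ?_ ?_ ?_ ?_ ?_
  · simp [colBlock, Block.phi]
  · simp [colBlock, Block.eps]
  · rintro r ((⟨⟨⟩⟩ | ⟨rfl, hr⟩) | ⟨⟨⟩⟩) j hj
    have := (List.mem_range'_1.1 hj).1
    simp [raise, colBlock, KPmove_apply]
    grind
  · intro j hj hj'
    have := (List.mem_range'_1.1 hj).1
    simp [raise, innerBlock₁, innerBlock₂, pairs, KPmove_apply]
    grind
  · intro j hj hj'
    have := (List.mem_range'_1.1 hj).1
    simp [raise, colBlock, Block.lower, KPmove_apply]
    grind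
  · intro j hj l hl hjl
    have := (List.mem_range'_1.1 hj).1
    have := (List.mem_range'_1.1 hl).1
    simp [raise, colBlock, KPmove_apply]
    grind

theorem linked_true {n k : ℕ} {α : KPf} (hα : IsKP n α) (h : k + 2 ≤ n) :
    ∃ Q, Linked true k α (Wstar n k α ++ Wword n k α) (blocks n k) Q := by
  rw [Wword_eq hα (by omega), ← List.append_assoc]
  obtain ⟨a1, a2, a3⟩ := reduceW_replicate_false (pairs k α) (k, k + 1)
  obtain ⟨b1, b2, b3⟩ := reduceW_replicate_false (α (k, k + 1) - pairs k α) (k, k + 1)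
  have h1 := (linked_col hα h).cons (C := innerBlock₃ k) (Q' := fun _ => False)
    (by rw [a1]; simp [innerBlock₃, Block.phi])
    (by rw [a2]; simp [innerBlock₃, Block.eps])
    (by simp [a3])
    (by
      rintro r (((⟨⟨⟩⟩ | ⟨rfl, hr⟩) | ⟨⟨⟩⟩) | ⟨j, hj, rfl, -⟩)
      · simp [raise, innerBlock₃, pairs, KPmove_apply]
        omega
      · have := (List.mem_range'_1.1 hj).1
        simp [raise, innerBlock₃, pairs, KPmove_apply]
        grind)
    (by simp) (by simp)
  have h2 := h1.cons (C := innerBlock₄ k) (Q' := fun _ => False)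
    (by rw [b1]; simp [innerBlock₄, Block.phi])
    (by rw [b2]; simp [innerBlock₄, Block.eps])
    (by simp [b3])
    (by
      rintro r ((((⟨⟨⟩⟩ | ⟨rfl, hr⟩) | ⟨⟨⟩⟩) | ⟨j, hj, rfl, -⟩) | ⟨⟨⟩⟩)
      · simp [raise, innerBlock₄, pairs, KPmove_apply]
        omega
      · have := (List.mem_range'_1.1 hj).1
        simp [raise, innerBlock₄, pairs, KPmove_apply]
        grind)
    (by simp) (by simp)
  rw [List.append_assoc, List.replicate_append_replicate,
    Nat.add_sub_cancel' (by simp [pairs])] at h2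
  refine ⟨_, h2.append (rowBlock k) (fun h => (h, k)) (fun h => (h, k + 1)) _
    (List.nodup_reverse.2 List.nodup_range) ?_ ?_ ?_ ?_ ?_ ?_⟩
  · simp [rowBlock, Block.phi]
  · simp [rowBlock, Block.eps]
  · rintro r (((((⟨⟨⟩⟩ | ⟨rfl, hr⟩) | ⟨⟨⟩⟩) | ⟨j, hj, rfl, -⟩) | ⟨⟨⟩⟩) | ⟨⟨⟩⟩) a ha
    · have := List.mem_range.1 (List.mem_reverse.1 ha)
      simp [raise, rowBlock, KPmove_apply]
      grind
    · have := (List.mem_range'_1.1 hj).1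
      have := List.mem_range.1 (List.mem_reverse.1 ha)
      simp [raise, rowBlock, KPmove_apply]
      grind
  · intro a ha ha'
    have ha := List.mem_range.1 (List.mem_reverse.1 ha)
    have hc : ∀ j ∈ (List.range' (k + 3) (n - k - 2)).reverse,
        colBlock k (KPmove α (a, k) (raise k (a, k))) j = colBlock k α j := by
      intro j hj
      have := (List.mem_range'_1.1 (List.mem_reverse.1 hj)).1
      simp [raise, colBlock, KPmove_apply]
      grind
    rw [List.map_congr_left hc]
    simp [raise, innerBlock₁, innerBlock₂, innerBlock₃, innerBlock₄, pairs, KPmove_apply]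
    grind
  · intro a ha ha'
    have := List.mem_range.1 (List.mem_reverse.1 ha)
    simp [raise, rowBlock, Block.lower, KPmove_apply]
  · intro a ha b hb hab
    have := List.mem_range.1 (List.mem_reverse.1 ha)
    have := List.mem_range.1 (List.mem_reverse.1 hb)
    simp [raise, rowBlock, KPmove_apply]
    grind

theorem linked_succ_col {n k : ℕ} {α : KPf} (hα : IsKP n α) (h : k + 2 ≤ n) :
    Linked false (k + 1) α (Wstar n (k + 1) α)
      (fun β => (List.range' (k + 3) (n - k - 2)).reverse.map (colBlock k β) ++
        [innerBlock₂ k β, innerBlock₁ k β])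
      (fun r => ((False ∨ False) ∨ False) ∨
        ∃ j ∈ List.range' (k + 3) (n - k - 2), r = (k + 2, j) ∧ 0 < α r) := by
  rw [Wstar_succ_eq hα h]
  obtain ⟨a1, a2, a3⟩ := reduceW_replicate_false (α (k + 1, k + 2) - pairs k α) (k + 1, k + 2)
  obtain ⟨b1, b2, b3⟩ := reduceW_replicate_false (pairs k α) (k + 1, k + 2)
  have h1 := (linked_nil false (k + 1) α).cons (C := innerBlock₁ k) (Q' := fun _ => False)
    (by rw [a1]; simp [innerBlock₁, Block.phi])
    (by rw [a2]; simp [innerBlock₁, Block.eps]) (by simp [a3]) (by simp) (by simp) (by simp)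
  have h2 := h1.cons (C := innerBlock₂ k) (Q' := fun _ => False)
    (by rw [b1]; simp [innerBlock₂, Block.phi])
    (by rw [b2]; simp [innerBlock₂, Block.eps]) (by simp [b3]) (by simp) (by simp) (by simp)
  rw [List.nil_append, List.replicate_append_replicate, Nat.sub_add_cancel (by simp [pairs])] at h2
  refine h2.append (colBlock k) (fun j => (k + 2, j)) (fun j => (k + 1, j)) _
    List.nodup_range' ?_ ?_ ?_ ?_ ?_ ?_
  · simp [colBlock, Block.phi]
  · simp [colBlock, Block.eps]
  · simp
  · intro j hj hj'
    have := (List.mem_range'_1.1 hj).1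
    simp [raise, innerBlock₁, innerBlock₂, pairs, KPmove_apply]
    grind
  · intro j hj hj'
    have := (List.mem_range'_1.1 hj).1
    simp [raise, colBlock, Block.lower, KPmove_apply]
    grind
  · intro j hj l hl hjl
    have := (List.mem_range'_1.1 hj).1
    have := (List.mem_range'_1.1 hl).1
    simp [raise, colBlock, KPmove_apply]
    grind

theorem linked_false {n k : ℕ} {α : KPf} (hα : IsKP n α) (h : k + 2 ≤ n) :
    ∃ Q, Linked false (k + 1) α (Wstar n (k + 1) α ++ Wword n (k + 1) α) (blocks n k) Q := by
  rw [Wword_succ_eq hα (by omega), ← List.append_assoc]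
  obtain ⟨a1, a2, a3⟩ := reduceW_minus_plus_minus (α (k + 1, k + 2)) (α (k, k + 1))
    (α (k, k + 2)) (k + 1, k + 2) (k, k + 1) (k, k + 2)
  have h1 := (linked_succ_col hα h).cons (C := innerBlock₃ k) (w' := []) (Q' := fun _ => False)
    (by simp [reduceW, plusCt, innerBlock₃, Block.phi])
    (by simp [reduceW, minusCt, innerBlock₃, Block.eps])
    (by simp [reduceW, lastPlus])
    (by
      rintro r (((⟨⟨⟩⟩ | ⟨⟨⟩⟩) | ⟨⟨⟩⟩) | ⟨j, hj, rfl, -⟩)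
      have := (List.mem_range'_1.1 hj).1
      simp [raise, innerBlock₃, pairs, KPmove_apply]
      grind)
    (by simp) (by simp)
  have h2 := h1.cons (C := innerBlock₄ k)
    (Q' := fun r => r = (k, k + 1) ∧ α (k + 1, k + 2) < α (k, k + 1))
    (by rw [a1]; simp [innerBlock₄, Block.phi, pairs]; omega)
    (by rw [a2]; simp [innerBlock₄, Block.eps, pairs]; omega)
    a3
    (by
      rintro r ((((⟨⟨⟩⟩ | ⟨⟨⟩⟩) | ⟨⟨⟩⟩) | ⟨j, hj, rfl, -⟩) | ⟨⟨⟩⟩)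
      have := (List.mem_range'_1.1 hj).1
      simp [raise, innerBlock₄, pairs, KPmove_apply]
      grind)
    (by
      rintro r ⟨rfl, hr⟩
      simp [raise, innerBlock₄, pairs, Block.lower, KPmove_apply]
      omega)
    (by
      rintro r ⟨rfl, hr⟩
      have hc : ∀ j ∈ (List.range' (k + 3) (n - k - 2)).reverse,
          colBlock k (KPmove α (k, k + 1) (raise (k + 1) (k, k + 1))) j = colBlock k α j := by
        intro j hj
        have := (List.mem_range'_1.1 (List.mem_reverse.1 hj)).1
        simp [raise, colBlock, KPmove_apply]
        grind
      simp only [List.map_congr_left hc]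
      simp [raise, innerBlock₁, innerBlock₂, innerBlock₃, pairs, KPmove_apply]
      omega)
  rw [List.append_nil] at h2
  refine ⟨_, h2.append (rowBlock k) (fun h => (h, k + 1)) (fun h => (h, k + 2)) _
    (List.nodup_reverse.2 List.nodup_range) ?_ ?_ ?_ ?_ ?_ ?_⟩
  · simp [rowBlock, Block.phi]
  · simp [rowBlock, Block.eps]
  · rintro r (((((⟨⟨⟩⟩ | ⟨⟨⟩⟩) | ⟨⟨⟩⟩) | ⟨j, hj, rfl, -⟩) | ⟨⟨⟩⟩) | ⟨rfl, hr⟩) a ha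
    · have := (List.mem_range'_1.1 hj).1
      have := List.mem_range.1 (List.mem_reverse.1 ha)
      simp [raise, rowBlock, KPmove_apply]
      grind
    · have := List.mem_range.1 (List.mem_reverse.1 ha)
      simp [raise, rowBlock, KPmove_apply]
      grind
  · intro a ha ha'
    have ha := List.mem_range.1 (List.mem_reverse.1 ha)
    have hc : ∀ j ∈ (List.range' (k + 3) (n - k - 2)).reverse,
        colBlock k (KPmove α (a, k + 1) (raise (k + 1) (a, k + 1))) j = colBlock k α j := by
      intro j hj
      have := (List.mem_range'_1.1 (List.mem_reverse.1 hj)).1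
      simp [raise, colBlock, KPmove_apply]
      grind
    rw [List.map_congr_left hc]
    simp [raise, innerBlock₁, innerBlock₂, innerBlock₃, innerBlock₄, pairs, KPmove_apply]
    grind
  · intro a ha ha'
    have := List.mem_range.1 (List.mem_reverse.1 ha)
    simp [raise, rowBlock, Block.lower, KPmove_apply]
    omega
  · intro a ha b hb hab
    have := List.mem_range.1 (List.mem_reverse.1 ha)
    have := List.mem_range.1 (List.mem_reverse.1 hb)
    simp [raise, rowBlock, KPmove_apply]
    grind

/-- The index of the operator corresponding to `o`, for the base index `k`. -/
def opIndex (k : ℕ) (o : Bool) : ℕ := if o then k else k + 1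

/-- The multiplicity of `p` is recorded by the blocks at the base index `k`. -/
def Recorded (k : ℕ) (p : Root) : Prop := k ≤ p.1 ∧ p.1 ≤ k + 2 ∨ k ≤ p.2 ∧ p.2 ≤ k + 2

theorem linked_opIndex {n k : ℕ} {α : KPf} (hα : IsKP n α) (h : k + 2 ≤ n) (o : Bool) :
    ∃ Q, Linked o (opIndex k o) α (Wstar n (opIndex k o) α ++ Wword n (opIndex k o) α)
      (blocks n k) Q := by
  cases o
  · exact linked_false hα h
  · exact linked_true hα h

theorem fop_ne_none {n k : ℕ} {α : KPf} (hα : IsKP n α) (h : k + 2 ≤ n) {o : Bool}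
    (hφ : 0 < Block.phiL o (blocks n k α)) : fop n (opIndex k o) α ≠ none := by
  obtain ⟨Q, -, h2, -⟩ := linked_opIndex hα h o
  rw [fop_eq hα, ne_eq, Option.map_eq_none_iff, lastPlus_eq_none_iff]
  omega

theorem fop_some {n k : ℕ} {α β : KPf} (hα : IsKP n α) (hk : 1 ≤ k) (h : k + 2 ≤ n) {o : Bool}
    (hβ : fop n (opIndex k o) α = some β) :
    IsKP n β ∧ (∀ p, ¬ Recorded k p → β p = α p) ∧
      Block.lowerL o (blocks n k α) = some (blocks n k β) := by
  obtain ⟨Q, -, -, h3⟩ := linked_opIndex hα h o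
  rw [fop_eq hα] at hβ
  obtain ⟨⟨a, b⟩, hr, rfl⟩ := Option.map_eq_some_iff.1 hβ
  refine ⟨?_, ?_, (h3 _ hr).2⟩
  · intro p hp
    by_cases hp' : p = raise (opIndex k o) (a, b)
    · have hi : 1 ≤ opIndex k o ∧ opIndex k o + 1 ≤ n := by
        cases o <;> simp [opIndex] <;> omega
      rcases List.mem_append.1 (mem_of_lastPlus hr) with hm | hm
      · obtain ⟨h4, h5⟩ := mem_Wstar_true hm
        obtain ⟨h6, h7, h8⟩ := hα _ h5.ne'
        subst hp'
        simp only at h4 h6 h7 h8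
        rw [raise, if_neg (by simp only; omega)]
        refine ⟨?_, ?_, ?_⟩ <;> simp only <;> omega
      · obtain ⟨h4, h5⟩ := mem_Wword_true hm
        obtain ⟨h6, h7, h8⟩ := hα _ h5.ne'
        subst hp'
        simp only at h4 h6 h7 h8
        rw [raise, if_pos h4]
        refine ⟨?_, ?_, ?_⟩ <;> simp only <;> omega
    · refine hα p ?_
      rw [KPmove_apply, if_neg hp'] at hp
      split_ifs at hp <;> omega
  · intro p hp
    have hi : k ≤ opIndex k o ∧ opIndex k o ≤ k + 1 := by cases o <;> simp [opIndex]
    have hab : a = opIndex k o + 1 ∨ b = opIndex k o := by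
      rcases List.mem_append.1 (mem_of_lastPlus hr) with hm | hm
      · exact Or.inl (mem_Wstar_true hm).1
      · exact Or.inr (mem_Wword_true hm).1
    rw [KPmove_apply, if_neg, if_neg]
    · rintro rfl
      exact hp (by simp only [Recorded]; omega)
    · rintro rfl
      refine hp ?_
      unfold raise Recorded
      split_ifs <;> simp only <;> omega

theorem iterO_fop {n k : ℕ} (hk : 1 ≤ k) (h : k + 2 ≤ n) (o : Bool) (m : ℕ) {α : KPf}
    (hα : IsKP n α) (hm : m ≤ Block.phiL o (blocks n k α)) :
    ∃ β, iterO (fop n (opIndex k o)) m α = some β ∧ IsKP n β ∧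
      (∀ p, ¬ Recorded k p → β p = α p) ∧
      Block.toLus (blocks n k β) =
        ((Lus.lower o)^[m] (Block.toLus (blocks n k α)).1, (Block.toLus (blocks n k α)).2) ∧
      Block.phiL (!o) (blocks n k β) + Block.epsL (!o) (blocks n k α) =
        Block.phiL (!o) (blocks n k α) + Block.epsL (!o) (blocks n k β) + m ∧
      Block.phiL o (blocks n k β) + m = Block.phiL o (blocks n k α) ∧
      Block.epsL o (blocks n k β) = Block.epsL o (blocks n k α) + m := by
  induction m generalizing α with
  | zero => exact ⟨α, rfl, hα, fun _ _ => rfl, rfl, rfl, rfl, rfl⟩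
  | succ m ih =>
    obtain ⟨γ, hγ⟩ := Option.ne_none_iff_exists'.1 (fop_ne_none hα h (o := o) (by omega))
    obtain ⟨a1, a2, a3⟩ := fop_some hα hk h hγ
    have a4 := Block.epsL_phiL_lowerL_self a3
    have a5 := Block.epsL_phiL_lowerL_other a3
    obtain ⟨β, b1, b2, b3, b4, b5, b6, b7⟩ := ih a1 (by omega)
    refine ⟨β, ?_, b2, fun p hp => (b3 p hp).trans (a2 p hp), ?_, by omega, by omega, by omega⟩
    · rw [iterO, hγ, Option.bind_some, b1]
    · rw [b4, Block.toLus_lowerL a3, Function.iterate_succ_apply]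

theorem blocks_injective {n k : ℕ} {α β : KPf} (hα : IsKP n α) (hβ : IsKP n β)
    (hαβ : ∀ p, ¬ Recorded k p → α p = β p) (h : blocks n k α = blocks n k β) : α = β := by
  unfold blocks at h
  obtain ⟨h1, h2⟩ := List.append_inj h (by simp)
  obtain ⟨h3, h2⟩ := List.cons_eq_cons.1 h2
  obtain ⟨h4, h2⟩ := List.cons_eq_cons.1 h2
  obtain ⟨h5, h2⟩ := List.append_inj h2 (by simp)
  simp only [List.cons.injEq, and_true] at h2
  obtain ⟨-, h6⟩ := h2
  rw [List.map_inj_left] at h1 h5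
  simp only [innerBlock₄, innerBlock₃, innerBlock₁, Block.mk.injEq] at h3 h4 h6
  have c1 : pairs k α ≤ α (k, k + 1) ∧ pairs k α ≤ α (k + 1, k + 2) := by simp [pairs]
  have c2 : pairs k β ≤ β (k, k + 1) ∧ pairs k β ≤ β (k + 1, k + 2) := by simp [pairs]
  funext ⟨a, b⟩
  by_cases hr : Recorded k (a, b)
  swap
  · exact hαβ _ hr
  by_cases hp : IsPos n (a, b)
  swap
  · rw [not_imp_comm.1 (hα _) hp, not_imp_comm.1 (hβ _) hp]
  simp only [Recorded] at hr
  obtain ⟨p1, p2, p3⟩ := hp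
  simp only at p1 p2 p3
  rcases lt_or_ge a k with ha | ha
  · have := h1 a (by simpa using ha)
    simp only [rowBlock, Block.mk.injEq] at this
    obtain rfl | rfl | rfl : b = k ∨ b = k + 1 ∨ b = k + 2 := by omega
    · exact this.2.1
    · exact this.2.2.1
    · exact this.2.2.2
  · rcases le_or_gt b (k + 2) with hb | hb
    · obtain ⟨rfl, rfl⟩ | ⟨rfl, rfl⟩ | ⟨rfl, rfl⟩ :
          a = k ∧ b = k + 1 ∨ a = k ∧ b = k + 2 ∨ a = k + 1 ∧ b = k + 2 := by omega
      · omega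
      · omega
      · omega
    · have := h5 b (by simp only [List.mem_reverse, List.mem_range'_1]; omega)
      simp only [colBlock, Block.mk.injEq] at this
      obtain rfl | rfl | rfl : a = k ∨ a = k + 1 ∨ a = k + 2 := by omega
      · exact this.2.2.2
      · exact this.2.2.1
      · exact this.2.1

/-- The Verma relation for the operators `f_k` and `f_{k+1}`. -/
theorem braid_fop {n k p q : ℕ} {α : KPf} (hk : 1 ≤ k) (h : k + 2 ≤ n) (hα : IsKP n α)
    (hp : p + Block.epsL true (blocks n k α) ≤ Block.phiL true (blocks n k α))
    (hq : q + Block.epsL false (blocks n k α) ≤ Block.phiL false (blocks n k α)) :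
    ∃ γ, ((iterO (fop n k) p α).bind (iterO (fop n (k + 1)) (p + q))).bind
        (iterO (fop n k) q) = some γ ∧
      ((iterO (fop n (k + 1)) q α).bind (iterO (fop n k) (p + q))).bind
        (iterO (fop n (k + 1)) p) = some γ := by
  obtain ⟨β₁, a1, a2, a3, a4, a5, a6, a7⟩ := iterO_fop hk h true p hα (by omega)
  simp only [Bool.not_true] at a5
  obtain ⟨β₂, b1, b2, b3, b4, b5, b6, b7⟩ := iterO_fop hk h false (p + q) a2 (by omega)
  simp only [Bool.not_false] at b5
  obtain ⟨β₃, c1, c2, c3, c4, -⟩ := iterO_fop hk h true q b2 (by omega)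
  obtain ⟨γ₁, d1, d2, d3, d4, d5, d6, d7⟩ := iterO_fop hk h false q hα (by omega)
  simp only [Bool.not_false] at d5
  obtain ⟨γ₂, e1, e2, e3, e4, e5, e6, e7⟩ := iterO_fop hk h true (p + q) d2 (by omega)
  simp only [Bool.not_true] at e5
  obtain ⟨γ₃, f1, f2, f3, f4, -⟩ := iterO_fop hk h false p e2 (by omega)
  have hγ : β₃ = γ₃ := by
    refine blocks_injective (n := n) (k := k) c2 f2 (fun r hr => ?_) (Block.toLus_injective ?_)
    · rw [c3 r hr, b3 r hr, a3 r hr, f3 r hr, e3 r hr, d3 r hr]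
    · rw [c4, b4, a4, f4, e4, d4, Lus.verma]
  simp only [opIndex, if_true, Bool.false_eq_true, if_false] at a1 b1 c1 d1 e1 f1
  exact ⟨β₃, by simp [a1, b1, c1], by simp [d1, e1, f1, hγ]⟩

theorem plusCt_append (w w' : List Entry) : plusCt (w ++ w') = plusCt w + plusCt w' := by
  simp [plusCt]

theorem minusCt_append (w w' : List Entry) : minusCt (w ++ w') = minusCt w + minusCt w' := by
  simp [minusCt]

theorem plusCt_flatMap (L : List ℕ) (f g : ℕ → ℕ) (p m : ℕ → Root) :
    plusCt (L.flatMap (fun a => List.replicate (f a) ((true, p a) : Entry) ++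
      List.replicate (g a) ((false, m a) : Entry))) = (L.map f).sum := by
  induction L with
  | nil => rfl
  | cons a L ih =>
    rw [List.flatMap_cons, plusCt_append, ih, plusCt_append]
    simp [plusCt]

theorem minusCt_flatMap (L : List ℕ) (f g : ℕ → ℕ) (p m : ℕ → Root) :
    minusCt (L.flatMap (fun a => List.replicate (f a) ((true, p a) : Entry) ++
      List.replicate (g a) ((false, m a) : Entry))) = (L.map g).sum := by
  induction L with
  | nil => rfl
  | cons a L ih =>
    rw [List.flatMap_cons, minusCt_append, ih, minusCt_append]
    simp [minusCt]

theorem kpEval_eq {n k : ℕ} (α : KPf) (hk : k ≤ n) :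
    kpEval n α k = ∑ b ∈ Finset.range (n + 1), (α (k, b) : ℤ) -
      ∑ a ∈ Finset.range (n + 1), (α (a, k) : ℤ) := by
  simp only [kpEval, kbox, mul_sub, Finset.sum_sub_distrib]
  congr 1
  · rw [Finset.sum_product_right]
    refine Finset.sum_congr rfl fun b _ => ?_
    simp [hk]
  · rw [Finset.sum_product]
    refine Finset.sum_congr rfl fun b _ => ?_
    simp [hk]

theorem plusCt_sub_minusCt_word {n i : ℕ} (α : KPf) (hi : i + 1 ≤ n) :
    (plusCt (Wstar n i α ++ Wword n i α) : ℤ) - minusCt (Wstar n i α ++ Wword n i α) =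
      -pairCo (kpEval n α) i := by
  have hs : ∀ f : ℕ → ℕ, (((List.range (n + 1)).map f).sum : ℤ) =
      ∑ a ∈ Finset.range (n + 1), (f a : ℤ) := by
    intro f
    rw [← Nat.cast_sum]
    rfl
  rw [pairCo, kpEval_eq α (by omega), kpEval_eq α hi, plusCt_append, minusCt_append, Wstar, Wword,
    plusCt_flatMap, plusCt_flatMap, minusCt_flatMap, minusCt_flatMap, List.map_reverse,
    List.map_reverse, List.sum_reverse, List.sum_reverse]
  push_cast [hs]
  ring

theorem phiL_sub_epsL {n k : ℕ} {α : KPf} (hα : IsKP n α) (h : k + 2 ≤ n) (o : Bool) :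
    (Block.phiL o (blocks n k α) : ℤ) - Block.epsL o (blocks n k α) =
      -pairCo (kpEval n α) (opIndex k o) := by
  obtain ⟨Q, h1, h2, -⟩ := linked_opIndex hα h o
  rw [h1, h2, plusCt_sub_minusCt_reduceW, plusCt_sub_minusCt_word]
  cases o <;> simp [opIndex] <;> omega

theorem InS.le_pairing {n : ℕ} {lam mu : ℕ → ℤ} {w : Equiv.Perm (Fin n)} {α : KPf}
    (hα : InS n lam mu w α) (hmu : ∀ k, 1 ≤ k → k < n → mu (k + 1) ≤ mu k) {i : ℕ} (hi : 1 ≤ i)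
    (hi' : i + 1 ≤ n) :
    -pairCo (permAct n w (lamRho n lam)) i ≤ -pairCo (kpEval n α) i := by
  have h1 := hα.2 i hi (by omega)
  have h2 := hα.2 (i + 1) (by omega) hi'
  have h3 := hmu i hi (by omega)
  simp only [pairCo, h1, h2, rhoVec]
  push_cast
  omega

theorem braid_of_mem {n : ℕ} {lam mu : ℕ → ℤ} (hmu : ∀ k, 1 ≤ k → k < n → mu (k + 1) ≤ mu k)
    {w : Equiv.Perm (Fin n)} {α : KPf} (hα : InS n lam mu w α) {k : ℕ} (hk : 1 ≤ k)
    (h : k + 2 ≤ n) {x y : ℤ} (hx : x = pairCo (permAct n w (lamRho n lam)) k)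
    (hy : y = pairCo (permAct n w (lamRho n lam)) (k + 1)) (hx0 : x < 0) (hy0 : y < 0) :
    ∃ γ, ((iterO (fop n k) (-x).toNat α).bind
          (iterO (fop n (k + 1)) ((-x).toNat + (-y).toNat))).bind
        (iterO (fop n k) (-y).toNat) = some γ ∧
      ((iterO (fop n (k + 1)) (-y).toNat α).bind
          (iterO (fop n k) ((-x).toNat + (-y).toNat))).bind
        (iterO (fop n (k + 1)) (-x).toNat) = some γ := by
  have h1 := phiL_sub_epsL hα.1 h true
  have h2 := phiL_sub_epsL hα.1 h false
  simp only [opIndex, if_true, Bool.false_eq_true, if_false] at h1 h2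
  have h3 := hα.le_pairing hmu hk (by omega)
  have h4 := hα.le_pairing hmu (show 1 ≤ k + 1 by omega) h
  exact braid_fop hk h hα.1 (by omega) (by omega)

end KFC


open KFC in
/-- Braid relation (adjacent case) for the `Φ` operators built from `f`: with
`p = −k_i`, `q = −k_j`, one has
`f_i^q(f_j^{p+q}(f_i^p(α))) = f_j^p(f_i^{p+q}(f_j^q(α))) ≠ 0`. -/
theorem stmt6 (n : ℕ) (hn : 2 ≤ n) (lam mu : ℕ → ℤ)
    (hlam : ∀ k, 1 ≤ k → k < n → lam (k+1) ≤ lam k) (hlamn : lam n = 0)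
    (hmu : ∀ k, 1 ≤ k → k < n → mu (k+1) ≤ mu k) (hmun : 0 ≤ mu n)
    (hcomb : ∃ c : ℕ → ℕ, c 0 = 0 ∧ c n = 0 ∧
      ∀ k, 1 ≤ k → k ≤ n → lam k - mu k = (c k : ℤ) - (c (k-1) : ℤ))
    (w : Equiv.Perm (Fin n)) (α : KPf) (hwα : InS n lam mu w α) (i j : ℕ)
    (hi1 : 1 ≤ i) (hi2 : i ≤ n - 1) (hj1 : 1 ≤ j) (hj2 : j ≤ n - 1)
    (hij : j = i + 1 ∨ i = j + 1)
    (ki kj : ℤ)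
    (hki : ki = pairCo (permAct n w (lamRho n lam)) i)
    (hkj : kj = pairCo (permAct n w (lamRho n lam)) j)
    (hki0 : ki < 0) (hkj0 : kj < 0)
    (hfi : iterO (fop n i) (-ki).toNat α ≠ none)
    (hfj : iterO (fop n j) (-kj).toNat α ≠ none) :
    ((iterO (fop n i) (-ki).toNat α).bind
        (iterO (fop n j) ((-ki).toNat + (-kj).toNat))).bind (iterO (fop n i) (-kj).toNat) =
      ((iterO (fop n j) (-kj).toNat α).bind
        (iterO (fop n i) ((-ki).toNat + (-kj).toNat))).bind (iterO (fop n j) (-ki).toNat) ∧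
    ((iterO (fop n i) (-ki).toNat α).bind
        (iterO (fop n j) ((-ki).toNat + (-kj).toNat))).bind (iterO (fop n i) (-kj).toNat) ≠ none := by
  subst hki hkj
  rcases hij with rfl | rfl
  · obtain ⟨γ, h1, h2⟩ := braid_of_mem hmu hwα hi1 (by omega) rfl rfl hki0 hkj0
    rw [h1, h2]
    exact ⟨rfl, Option.some_ne_none γ⟩
  · obtain ⟨γ, h1, h2⟩ := braid_of_mem hmu hwα hj1 (by omega) rfl rfl hkj0 hki0
    rw [add_comm (-pairCo (permAct n w (lamRho n lam)) (j + 1)).toNat, h1, h2]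
    exact ⟨rfl, Option.some_ne_none γ⟩
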